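/- arXiv:1206.0229 — 2 statements merged into one kernel-verified Lean document; each statement's English description precedes it below -/
import Mathlib

section
/- The constants K_n = ((n+1)/n) · (Γ(n)Γ((n+1)/2)/(Γ(n+1/2)Γ(n/2)))^{2/n} satisfy: K₂ = 1, 1 < K_n ≤ 1.04 for all n ≥ 3, and K_n → 1 as n → ∞. -/
open Real Filter
open scoped Topology

noncomputable section

/-- The constant `K_n = ((n+1)/n) · (Γ(n)Γ((n+1)/2)/(Γ(n+1/2)Γ(n/2)))^{2/n}`. -/
def Kconst (n : ℕ) : ℝ :=
  ((n + 1 : ℝ) / n) *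
    ((Real.Gamma n * Real.Gamma ((n + 1) / 2)) /
      (Real.Gamma (n + 1 / 2) * Real.Gamma (n / 2))) ^ ((2 : ℝ) / n)

/-- The ratio of Gamma values whose power `2 / n` appears in `Kconst n`. -/
def gammaRatio (x : ℝ) : ℝ :=
  (Real.Gamma x * Real.Gamma ((x + 1) / 2)) / (Real.Gamma (x + 1 / 2) * Real.Gamma (x / 2))

lemma gammaRatio_pos {x : ℝ} (hx : 0 < x) : 0 < gammaRatio x := by
  unfold gammaRatio
  have h₁ := Real.Gamma_pos_of_pos hx
  have h₂ := Real.Gamma_pos_of_pos (show 0 < (x + 1) / 2 by positivity)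
  have h₃ := Real.Gamma_pos_of_pos (show 0 < x + 1 / 2 by positivity)
  have h₄ := Real.Gamma_pos_of_pos (show 0 < x / 2 by positivity)
  positivity

lemma gammaRatio_add_two {x : ℝ} (hx : 0 < x) :
    gammaRatio (x + 2) = gammaRatio x * ((x + 1) ^ 2 / ((x + 1 / 2) * (x + 3 / 2))) := by
  unfold gammaRatio
  have h₁ : Real.Gamma (x + 2) = (x + 1) * (x * Real.Gamma x) := by
    rw [← Real.Gamma_add_one hx.ne', ← Real.Gamma_add_one (by positivity)]
    ring_nf
  have h₂ : Real.Gamma ((x + 2 + 1) / 2) = (x + 1) / 2 * Real.Gamma ((x + 1) / 2) := by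
    rw [← Real.Gamma_add_one (by positivity)]
    ring_nf
  have h₃ : Real.Gamma (x + 2 + 1 / 2) =
      (x + 3 / 2) * ((x + 1 / 2) * Real.Gamma (x + 1 / 2)) := by
    rw [← Real.Gamma_add_one (by positivity), show x + 3 / 2 = x + 1 / 2 + 1 by ring,
      ← Real.Gamma_add_one (by positivity)]
    ring_nf
  have h₄ : Real.Gamma ((x + 2) / 2) = x / 2 * Real.Gamma (x / 2) := by
    rw [← Real.Gamma_add_one (by positivity)]
    ring_nf
  have p₃ := Real.Gamma_pos_of_pos (show 0 < x + 1 / 2 by positivity)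
  have p₄ := Real.Gamma_pos_of_pos (show 0 < x / 2 by positivity)
  rw [h₁, h₂, h₃, h₄]
  field_simp

lemma gammaRatio_one : gammaRatio 1 = 2 / π := by
  have h : Real.Gamma (1 + 1 / 2) = 1 / 2 * √π := by
    rw [add_comm, Real.Gamma_add_one (by norm_num), Real.Gamma_one_half_eq]
  have hs : √π * √π = π := Real.mul_self_sqrt Real.pi_pos.le
  unfold gammaRatio
  rw [h, Real.Gamma_one_half_eq, show ((1 : ℝ) + 1) / 2 = 1 by norm_num, Real.Gamma_one,
    mul_assoc, hs]
  field_simp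

lemma gammaRatio_two : gammaRatio 2 = 2 / 3 := by
  have h : Real.Gamma (2 + 1 / 2) = 3 / 2 * Real.Gamma ((2 + 1) / 2) := by
    rw [show (2 : ℝ) + 1 / 2 = 3 / 2 + 1 by norm_num, Real.Gamma_add_one (by norm_num)]
    norm_num
  have p := Real.Gamma_pos_of_pos (show (0 : ℝ) < (2 + 1) / 2 by norm_num)
  unfold gammaRatio
  rw [h, Real.Gamma_two, show (2 : ℝ) / 2 = 1 by norm_num, Real.Gamma_one]
  field_simp

lemma gammaRatio_three : gammaRatio 3 = 32 / (15 * π) := by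
  rw [show (3 : ℝ) = 1 + 2 by norm_num, gammaRatio_add_two one_pos, gammaRatio_one]
  field_simp
  norm_num

lemma gammaRatio_four : gammaRatio 4 = 24 / 35 := by
  rw [show (4 : ℝ) = 2 + 2 by norm_num, gammaRatio_add_two two_pos, gammaRatio_two]
  norm_num

lemma gammaRatio_sq_bounds (n : ℕ) (hn : 3 ≤ n) :
    0.45 ≤ gammaRatio n ^ 2 ∧ gammaRatio n ^ 2 ≤ 0.516 * (3 * n / (3 * n + 1)) := by
  induction n using Nat.strong_induction_on with
  | _ n ih =>
    obtain rfl | rfl | h : n = 3 ∨ n = 4 ∨ 5 ≤ n := by omega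
    · have h₁ := Real.pi_gt_d2
      have h₂ := Real.pi_lt_d2
      have hp := Real.pi_pos
      push_cast
      rw [gammaRatio_three, div_pow]
      constructor
      · rw [le_div_iff₀ (by positivity)]
        nlinarith
      · rw [div_le_iff₀ (by positivity)]
        nlinarith
    · push_cast
      rw [gammaRatio_four]
      norm_num
    · obtain ⟨m, rfl⟩ : ∃ m, n = m + 2 := ⟨n - 2, by omega⟩
      obtain ⟨hl, hu⟩ := ih m (by omega) (by omega)
      have hm : (3 : ℝ) ≤ m := by exact_mod_cast (by omega : 3 ≤ m)
      push_cast
      rw [gammaRatio_add_two (by linarith), mul_pow]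
      generalize (m : ℝ) = x at *
      constructor
      · have : 1 ≤ (x + 1) ^ 2 / ((x + 1 / 2) * (x + 3 / 2)) := by
          rw [le_div_iff₀ (by positivity)]
          nlinarith
        nlinarith [one_le_pow₀ this (n := 2)]
      · have key : ((x + 1) ^ 2 / ((x + 1 / 2) * (x + 3 / 2))) ^ 2 ≤
            1 + 2 / (x * (3 * x + 7)) := by
          obtain ⟨y, hy, rfl⟩ : ∃ y, 0 ≤ y ∧ x = y + 3 := ⟨x - 3, by linarith, by ring⟩
          rw [div_pow, ← sub_nonneg]
          have : 1 + 2 / ((y + 3) * (3 * (y + 3) + 7)) -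
              ((y + 3 + 1) ^ 2) ^ 2 / ((y + 3 + 1 / 2) * (y + 3 + 3 / 2)) ^ 2 =
              (921/8 + 1817/16 * y + 691/16 * y ^ 2 + 15/2 * y ^ 3 + 1/2 * y ^ 4) /
              (((y + 3) * (3 * (y + 3) + 7)) * ((y + 3 + 1 / 2) * (y + 3 + 3 / 2)) ^ 2) := by
            field_simp
            ring
          rw [this]
          positivity
        calc _ ≤ 0.516 * (3 * x / (3 * x + 1)) * (1 + 2 / (x * (3 * x + 7))) := by gcongr
          _ = _ := by
            field_simp
            ring

lemma one_add_pow_ge_quadratic {x : ℝ} (hx : 0 ≤ x) (n : ℕ) :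
    1 + n * x + n * (n - 1) / 2 * x ^ 2 ≤ (1 + x) ^ n := by
  induction n with
  | zero => simp
  | succ k ih =>
    rw [pow_succ (1 + x)]
    have h : 0 ≤ (k : ℝ) * (k - 1) := by
      rcases k with _ | k
      · simp
      · push_cast
        simp only [add_sub_cancel_right]
        positivity
    have h₁ := mul_le_mul_of_nonneg_right ih (by linarith : 0 ≤ 1 + x)
    have h₂ : 0 ≤ (k : ℝ) * (k - 1) * x ^ 3 := by positivity
    push_cast
    nlinarith

lemma one_add_inv_pow_lower (n : ℕ) (hn : 3 ≤ n) :
    7 / 3 ≤ (((n : ℝ) + 1) / n) ^ n := by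
  have hn' : (3 : ℝ) ≤ n := by exact_mod_cast hn
  have h := one_add_pow_ge_quadratic (x := 1 / (n : ℝ)) (by positivity) n
  rw [show ((n : ℝ) + 1) / n = 1 + 1 / n by field_simp]
  refine le_trans ?_ h
  rw [show 1 + n * (1 / (n : ℝ)) + n * (n - 1) / 2 * (1 / n) ^ 2 = (5 * n - 1) / (2 * n) by
    field_simp; ring, le_div_iff₀ (by positivity)]
  linarith

lemma one_add_inv_pow_upper (n : ℕ) (hn : 3 ≤ n) :
    (((n : ℝ) + 1) / n) ^ n * (0.516 * (3 * n / (3 * n + 1))) ≤ 1.04 ^ n := by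
  obtain h | h : n ≤ 8 ∨ 9 ≤ n := by omega
  · interval_cases n <;> norm_num
  · have hn' : (9 : ℝ) ≤ n := by exact_mod_cast h
    have h₁ : (((n : ℝ) + 1) / n) ^ n ≤ 2.7182818286 := by
      refine le_trans ?_ Real.exp_one_lt_d9.le
      calc (((n : ℝ) + 1) / n) ^ n ≤ Real.exp (1 / n) ^ n := by
            gcongr
            rw [show ((n : ℝ) + 1) / n = 1 / n + 1 by field_simp; ring]
            exact Real.add_one_le_exp _
        _ = Real.exp 1 := by
            rw [← Real.exp_nat_mul]
            field_simp
    have h₂ : 3 * (n : ℝ) / (3 * n + 1) ≤ 1 := by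
      rw [div_le_one (by positivity)]
      linarith
    calc _ ≤ (2.7182818286 : ℝ) * (0.516 * 1) := by gcongr
      _ ≤ 1.04 ^ 9 := by norm_num
      _ ≤ 1.04 ^ n := pow_le_pow_right₀ (by norm_num) h

lemma Kconst_eq (n : ℕ) :
    Kconst n = (((n : ℝ) + 1) / n) * gammaRatio n ^ ((2 : ℝ) / n) := rfl

lemma Kconst_pow {n : ℕ} (hn : 0 < n) :
    Kconst n ^ n = (((n : ℝ) + 1) / n) ^ n * gammaRatio n ^ 2 := by
  have hn' : (0 : ℝ) < n := by exact_mod_cast hn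
  rw [Kconst_eq, mul_pow, ← Real.rpow_mul_natCast (gammaRatio_pos hn').le,
    div_mul_cancel₀ _ hn'.ne', Real.rpow_two]

lemma Kconst_pos {n : ℕ} (hn : 0 < n) : 0 < Kconst n := by
  have hn' : (0 : ℝ) < n := by exact_mod_cast hn
  have := gammaRatio_pos hn'
  rw [Kconst_eq]
  positivity

lemma Kconst_two : Kconst 2 = 1 := by
  rw [Kconst_eq]
  push_cast
  rw [gammaRatio_two]
  norm_num

lemma one_lt_Kconst {n : ℕ} (hn : 3 ≤ n) : 1 < Kconst n := by
  refine lt_of_pow_lt_pow_left₀ n (Kconst_pos (by omega)).le ?_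
  rw [one_pow, Kconst_pow (by omega)]
  have h₁ := one_add_inv_pow_lower n hn
  have h₂ := (gammaRatio_sq_bounds n hn).1
  nlinarith

lemma Kconst_le {n : ℕ} (hn : 3 ≤ n) : Kconst n ≤ 1.04 := by
  refine le_of_pow_le_pow_left₀ (n := n) (by omega) (by norm_num) ?_
  rw [Kconst_pow (by omega)]
  refine le_trans ?_ (one_add_inv_pow_upper n hn)
  gcongr
  exact (gammaRatio_sq_bounds n hn).2

lemma Kconst_le_one_add_inv {n : ℕ} (hn : 3 ≤ n) : Kconst n ≤ 1 + 1 / (n : ℝ) := by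
  have hn' : (3 : ℝ) ≤ n := by exact_mod_cast hn
  have hpos := gammaRatio_pos (x := n) (by linarith)
  have h₁ : 3 * (n : ℝ) / (3 * n + 1) ≤ 1 := by
    rw [div_le_one (by positivity)]
    linarith
  have h₂ : gammaRatio n ≤ 1 := by
    nlinarith [(gammaRatio_sq_bounds n hn).2]
  rw [Kconst_eq, show 1 + 1 / (n : ℝ) = (n + 1) / n by field_simp]
  exact mul_le_of_le_one_right (by positivity)
    (Real.rpow_le_one hpos.le h₂ (by positivity))

lemma tendsto_Kconst : Tendsto Kconst atTop (𝓝 1) := by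
  have h : Tendsto (fun n : ℕ => 1 + 1 / (n : ℝ)) atTop (𝓝 1) := by
    simpa using tendsto_one_div_atTop_nhds_zero_nat.const_add (1 : ℝ)
  refine tendsto_of_tendsto_of_tendsto_of_le_of_le' tendsto_const_nhds h ?_ ?_
  · filter_upwards [eventually_ge_atTop 3] with n hn using (one_lt_Kconst hn).le
  · filter_upwards [eventually_ge_atTop 3] with n hn using Kconst_le_one_add_inv hn

/-- `K₂ = 1`, `1 < K_n ≤ 1.04` for all `n ≥ 3`, and `K_n → 1` as `n → ∞`. -/
theorem Kconst_properties :
    Kconst 2 = 1 ∧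
      (∀ n : ℕ, 3 ≤ n → 1 < Kconst n ∧ Kconst n ≤ 1.04) ∧
      Tendsto Kconst atTop (𝓝 1) :=
  ⟨Kconst_two, fun _ hn => ⟨one_lt_Kconst hn, Kconst_le hn⟩, tendsto_Kconst⟩

end
end

section
/- Let a = a_{r,p} be a cap and a* = S^n \ cl(a) its symmetric cap. Write ξ = ξ(a) and ξ* = ξ(a*) for the renormalization points of μ_a and μ_{a*}. Then −ξ* = τ_a(−ξ). -/
open MeasureTheory Metric Real Filter Set
open scoped RealInnerProductSpace ENNReal NNReal Topology Classical

noncomputable section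

/-- Ambient Euclidean space `ℝ^{n+1}`. -/
abbrev Eu (n : ℕ) : Type := EuclideanSpace ℝ (Fin (n + 1))

/-- The unit sphere `S^n ⊆ ℝ^{n+1}` as a subset of the ambient space. -/
def sphSet (n : ℕ) : Set (Eu n) := Metric.sphere (0 : Eu n) 1

/-- The canonical (round) volume measure of `S^n`, viewed as a measure on the
ambient space `ℝ^{n+1}` supported on the unit sphere. -/
def sphMeasure (n : ℕ) : Measure (Eu n) :=
  Measure.map Subtype.val ((volume : Measure (Eu n)).toSphere)

/-- `σ_n`, the volume of the round unit `n`-sphere. -/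
def sigmaVol (n : ℕ) : ℝ := (sphMeasure n Set.univ).toReal

/-- The linear coordinate function `X_s(x) = s · x`. -/
def Xfun {n : ℕ} (s x : Eu n) : ℝ := ⟪s, x⟫

/-- The tangential gradient on the sphere of (the restriction of) an ambient function:
`∇_{S^n} f (x) = ∇f(x) - ⟨∇f(x), x⟩ x`. -/
def gradS {n : ℕ} (f : Eu n → ℝ) (x : Eu n) : Eu n :=
  gradient f x - ⟪gradient f x, x⟫ • x

/-- A conformal factor `w` represents the metric `g = w² g₀` on `S^n`; it is admissible if it
is smooth and positive on the sphere. -/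
def IsConformalFactor (n : ℕ) (w : Eu n → ℝ) : Prop :=
  ContDiff ℝ (⊤ : ℕ∞) w ∧ ∀ x ∈ sphSet n, 0 < w x

/-- The Riemannian measure `dv_g` of the conformal metric `g = w² g₀`, i.e. `w^n dv_{g₀}`. -/
def confMeasure (n : ℕ) (w : Eu n → ℝ) : Measure (Eu n) :=
  (sphMeasure n).withDensity fun x => ENNReal.ofReal (w x ^ n)

/-- The volume of `(S^n, g)`, `g = w² g₀`. -/
def confVol (n : ℕ) (w : Eu n → ℝ) : ℝ := (confMeasure n w Set.univ).toReal

/-- The Dirichlet energy `∫ |∇_g u|²_g dv_g` of the restriction to `S^n` of `V`,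
for `g = w² g₀`: it equals `∫ w^{n-2} |∇_{g₀} V|²_{g₀} dv_{g₀}`. -/
def dirichlet (n : ℕ) (w : Eu n → ℝ) (V : Eu n → ℝ) : ℝ :=
  ∫ x, w x ^ (n - 2) * ‖gradS V x‖ ^ 2 ∂(sphMeasure n)

/-- `∫ u² dv_g`. -/
def l2sq (n : ℕ) (w : Eu n → ℝ) (V : Eu n → ℝ) : ℝ :=
  ∫ x, (V x) ^ 2 ∂(confMeasure n w)

/-- Mean value zero w.r.t. `dv_g`. -/
def MeanZero (n : ℕ) (w : Eu n → ℝ) (V : Eu n → ℝ) : Prop :=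
  ∫ x, V x ∂(confMeasure n w) = 0

/-- The second nonzero eigenvalue `λ₂(S^n, g)` of the Laplace–Beltrami operator of
`g = w² g₀`, defined via the Courant–Fischer min-max characterization over two-dimensional
spaces of mean-zero test functions (restrictions of smooth ambient functions). -/
def lambda2 (n : ℕ) (w : Eu n → ℝ) : ℝ :=
  sInf { Λ : ℝ | ∃ V W : Eu n → ℝ, ContDiff ℝ (⊤ : ℕ∞) V ∧ ContDiff ℝ (⊤ : ℕ∞) W ∧
    MeanZero n w V ∧ MeanZero n w W ∧
    (∀ a b : ℝ, (∀ x ∈ sphSet n, a * V x + b * W x = 0) → a = 0 ∧ b = 0) ∧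
    Λ = sSup { q : ℝ | ∃ a b : ℝ, ¬(a = 0 ∧ b = 0) ∧
      q = dirichlet n w (fun x => a * V x + b * W x) /
          l2sq n w (fun x => a * V x + b * W x) } }

/-- The conformal transformation `d_ξ` of the closed unit ball. -/
def dMap {n : ℕ} (ξ : Eu n) (x : Eu n) : Eu n :=
  (1 + 2 * ⟪ξ, x⟫ + ‖x‖ ^ 2 * ‖ξ‖ ^ 2)⁻¹ •
    ((1 - ‖ξ‖ ^ 2) • x + (1 + 2 * ⟪ξ, x⟫ + ‖x‖ ^ 2) • ξ)

/-- The reflection `R_p(x) = x - 2(p·x)p`. -/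
def Refl {n : ℕ} (p x : Eu n) : Eu n := x - (2 * ⟪p, x⟫) • p

/-- The spherical cap `a_{r,p} = d_{rp}(a_{0,p})`. -/
def cap (n : ℕ) (r : ℝ) (p : Eu n) : Set (Eu n) :=
  dMap (r • p) '' {x ∈ sphSet n | 0 < ⟪p, x⟫}

/-- The conformal reflection `τ_{a_{r,p}} = d_{rp} ∘ R_p ∘ d_{-rp}`. -/
def tauMap {n : ℕ} (r : ℝ) (p : Eu n) : Eu n → Eu n :=
  dMap (r • p) ∘ Refl p ∘ dMap (-(r • p))

/-- The measure `μ_{a_{r,p}}`, equal to `dv_g + (τ_a)^* dv_g` on `a` and `0` on `a^*`. -/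
def capMeasure (n : ℕ) (w : Eu n → ℝ) (r : ℝ) (p : Eu n) : Measure (Eu n) :=
  (confMeasure n w + Measure.map (tauMap r p) (confMeasure n w)).restrict (cap n r p)

/-- `d_ξ` renormalizes the finite measure `μ`: `∫ X_s ∘ d_ξ dμ = 0` for all `s ∈ S^n`. -/
def Renormalizes {n : ℕ} (ξ : Eu n) (μ : Measure (Eu n)) : Prop :=
  ∀ s ∈ sphSet n, ∫ x, Xfun s (dMap ξ x) ∂μ = 0

/-- The quadratic form `Q(s) = ∫ X_s² dν` of a measure `ν`. -/
def Qform {n : ℕ} (ν : Measure (Eu n)) (s : Eu n) : ℝ := ∫ x, (⟪s, x⟫ : ℝ) ^ 2 ∂ν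

/-- The maximal eigenvalue of the quadratic form `Q`. -/
def maxEig (n : ℕ) (ν : Measure (Eu n)) : ℝ :=
  sSup { q : ℝ | ∃ s : Eu n, ‖s‖ = 1 ∧ q = Qform ν s }

/-- `ν` is simple with (unit) maximal direction `s₀`: the eigenspace of the maximal
eigenvalue of `Q` is the line spanned by `s₀`. -/
def IsMaxDir {n : ℕ} (ν : Measure (Eu n)) (s₀ : Eu n) : Prop :=
  ‖s₀‖ = 1 ∧ ∀ s : Eu n, Qform ν s = maxEig n ν * ‖s‖ ^ 2 ↔ ∃ c : ℝ, s = c • s₀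

/-- `ν` is multiple: the eigenspace of the maximal eigenvalue of `Q` has dimension ≥ 2. -/
def IsMultiple {n : ℕ} (ν : Measure (Eu n)) : Prop :=
  ∃ s t : Eu n, Qform ν s = maxEig n ν * ‖s‖ ^ 2 ∧ Qform ν t = maxEig n ν * ‖t‖ ^ 2 ∧
    LinearIndependent ℝ ![s, t]

/-- The test function `u_a^s` (for `a = a_{r,p}` with renormalization point `ξ`):
`X_s ∘ d_ξ` on `a` and `X_s ∘ d_ξ ∘ τ_a` on `a^*`. -/
def testFun (n : ℕ) (ξ : Eu n) (r : ℝ) (p : Eu n) (s : Eu n) (x : Eu n) : ℝ :=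
  if 0 < ⟪p, dMap (-(r • p)) x⟫ then Xfun s (dMap ξ x) else Xfun s (dMap ξ (tauMap r p x))

/-- The first coordinate vector `e₁ ∈ ℝ^{n+1}`. -/
def e1 (n : ℕ) : Eu n := EuclideanSpace.single 0 1

/-- The denominator of `dMap`. -/
def dDen {n : ℕ} (ξ x : Eu n) : ℝ := 1 + 2 * ⟪ξ, x⟫ + ‖x‖ ^ 2 * ‖ξ‖ ^ 2

lemma dDen_pos {n : ℕ} {ξ x : Eu n} (hξ : ‖ξ‖ < 1) (hx : ‖x‖ ≤ 1) : 0 < dDen ξ x := by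
  have h := neg_le_of_abs_le (abs_real_inner_le_norm ξ x)
  have h1 : ‖ξ‖ * ‖x‖ < 1 := by nlinarith [norm_nonneg ξ, norm_nonneg x]
  unfold dDen
  nlinarith [mul_pos (sub_pos.2 h1) (sub_pos.2 h1)]

lemma inner_dMap {n : ℕ} (ξ x y : Eu n) :
    ⟪y, dMap ξ x⟫ = ((1 - ‖ξ‖ ^ 2) * ⟪y, x⟫ +
      (1 + 2 * ⟪ξ, x⟫ + ‖x‖ ^ 2) * ⟪y, ξ⟫) / dDen ξ x := by
  simp only [dMap, dDen, inner_smul_right, inner_add_right]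
  ring

lemma inner_dMap_dMap {n : ℕ} (ξ x z : Eu n) :
    ⟪dMap ξ x, dMap ξ z⟫ =
      ((1 - ‖ξ‖ ^ 2) * ((1 - ‖ξ‖ ^ 2) * ⟪x, z⟫ + (1 + 2 * ⟪ξ, x⟫ + ‖x‖ ^ 2) * ⟪ξ, z⟫) +
      (1 + 2 * ⟪ξ, z⟫ + ‖z‖ ^ 2) * ((1 - ‖ξ‖ ^ 2) * ⟪ξ, x⟫ +
        (1 + 2 * ⟪ξ, x⟫ + ‖x‖ ^ 2) * ‖ξ‖ ^ 2)) / (dDen ξ x * dDen ξ z) := by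
  rw [inner_dMap, real_inner_comm z, real_inner_comm ξ (dMap ξ x), inner_dMap, inner_dMap,
    real_inner_comm x z, real_inner_self_eq_norm_sq]
  rw [real_inner_comm z ξ]
  ring

lemma norm_dMap_sq {n : ℕ} {ξ x : Eu n} (h : dDen ξ x ≠ 0) :
    ‖dMap ξ x‖ ^ 2 = 1 - (1 - ‖ξ‖ ^ 2) * (1 - ‖x‖ ^ 2) / dDen ξ x := by
  rw [← real_inner_self_eq_norm_sq, inner_dMap_dMap, real_inner_self_eq_norm_sq]
  field_simp
  simp only [dDen]
  ring

lemma norm_dMap_sub_dMap_sq {n : ℕ} {ξ x z : Eu n} (hx : dDen ξ x ≠ 0) (hz : dDen ξ z ≠ 0) :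
    ‖dMap ξ x - dMap ξ z‖ ^ 2 = (1 - ‖ξ‖ ^ 2) ^ 2 * ‖x - z‖ ^ 2 / (dDen ξ x * dDen ξ z) := by
  rw [norm_sub_sq_real, norm_sub_sq_real, norm_dMap_sq hx, norm_dMap_sq hz, inner_dMap_dMap]
  field_simp
  simp only [dDen]
  ring

lemma dDen_neg_dMap {n : ℕ} {ξ x : Eu n} (h : dDen ξ x ≠ 0) :
    dDen (-ξ) (dMap ξ x) = (1 - ‖ξ‖ ^ 2) ^ 2 / dDen ξ x := by
  rw [dDen, norm_dMap_sq h, inner_neg_left, inner_dMap, norm_neg, real_inner_self_eq_norm_sq]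
  field_simp
  simp only [dDen]
  ring

lemma norm_dMap_le_one {n : ℕ} {ξ x : Eu n} (hξ : ‖ξ‖ < 1) (hx : ‖x‖ ≤ 1) :
    ‖dMap ξ x‖ ≤ 1 := by
  have hD := dDen_pos hξ hx
  have h1 : 0 ≤ 1 - ‖ξ‖ ^ 2 := by nlinarith [norm_nonneg ξ]
  have h2 : 0 ≤ 1 - ‖x‖ ^ 2 := by nlinarith [norm_nonneg x]
  rw [← sq_le_one_iff₀ (norm_nonneg _), norm_dMap_sq hD.ne']
  linarith [div_nonneg (mul_nonneg h1 h2) hD.le]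

lemma norm_dMap_lt_one {n : ℕ} {ξ x : Eu n} (hξ : ‖ξ‖ < 1) (hx : ‖x‖ < 1) :
    ‖dMap ξ x‖ < 1 := by
  have hD := dDen_pos hξ hx.le
  have h1 : 0 < 1 - ‖ξ‖ ^ 2 := by nlinarith [norm_nonneg ξ]
  have h2 : 0 < 1 - ‖x‖ ^ 2 := by nlinarith [norm_nonneg x]
  rw [← sq_lt_one_iff₀ (norm_nonneg _), norm_dMap_sq hD.ne']
  linarith [div_pos (mul_pos h1 h2) hD]

lemma norm_dMap_eq_one {n : ℕ} {ξ x : Eu n} (hξ : ‖ξ‖ < 1) (hx : ‖x‖ = 1) :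
    ‖dMap ξ x‖ = 1 := by
  have hD := dDen_pos hξ hx.le
  rw [← pow_eq_one_iff_of_nonneg (norm_nonneg _) two_ne_zero, norm_dMap_sq hD.ne', hx]
  simp

lemma dMap_neg_dMap {n : ℕ} {ξ x : Eu n} (hξ : ‖ξ‖ < 1) (hx : ‖x‖ ≤ 1) :
    dMap (-ξ) (dMap ξ x) = x := by
  have hD := (dDen_pos hξ hx).ne'
  have h1 : 1 - ‖ξ‖ ^ 2 ≠ 0 := by nlinarith [norm_nonneg ξ]
  have key := dDen_neg_dMap hD
  rw [dMap, ← dDen, key, norm_dMap_sq hD, inner_neg_left, inner_dMap, norm_neg,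
    real_inner_self_eq_norm_sq]
  rw [dMap, ← dDen]
  match_scalars
  · field_simp
  · field_simp
    simp only [dDen]
    ring

lemma dMap_zero_right {n : ℕ} (ξ : Eu n) : dMap ξ 0 = ξ := by
  simp [dMap]

lemma inner_Refl_Refl {n : ℕ} {p : Eu n} (hp : ‖p‖ = 1) (x y : Eu n) :
    ⟪Refl p x, Refl p y⟫ = ⟪x, y⟫ := by
  simp only [Refl, inner_sub_left, inner_sub_right, inner_smul_left, inner_smul_right,
    real_inner_self_eq_norm_sq, hp, real_inner_comm x p]
  simp
  ring

lemma norm_Refl {n : ℕ} {p : Eu n} (hp : ‖p‖ = 1) (x : Eu n) : ‖Refl p x‖ = ‖x‖ := by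
  rw [← sq_eq_sq₀ (norm_nonneg _) (norm_nonneg _), ← real_inner_self_eq_norm_sq,
    inner_Refl_Refl hp, real_inner_self_eq_norm_sq]

lemma inner_self_Refl {n : ℕ} {p : Eu n} (hp : ‖p‖ = 1) (x : Eu n) :
    ⟪p, Refl p x⟫ = -⟪p, x⟫ := by
  simp only [Refl, inner_sub_right, inner_smul_right, real_inner_self_eq_norm_sq, hp]
  ring

lemma Refl_Refl {n : ℕ} {p : Eu n} (hp : ‖p‖ = 1) (x : Eu n) : Refl p (Refl p x) = x := by
  rw [Refl, inner_self_Refl hp, Refl]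
  module

lemma Refl_sub {n : ℕ} (p x y : Eu n) : Refl p x - Refl p y = Refl p (x - y) := by
  simp only [Refl, inner_sub_right]
  module

lemma norm_smul_lt_one {n : ℕ} {r : ℝ} (hr : r ∈ Ioo (-1 : ℝ) 1) {p : Eu n} (hp : ‖p‖ = 1) :
    ‖r • p‖ < 1 := by
  rw [norm_smul, hp, mul_one, Real.norm_eq_abs]
  exact abs_lt.2 hr

/-- The Poisson-type kernel `‖x - z‖² / (1 - ‖z‖²)`. -/
def kernB {n : ℕ} (x z : Eu n) : ℝ := ‖x - z‖ ^ 2 / (1 - ‖z‖ ^ 2)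

lemma kernB_pos {n : ℕ} {x z : Eu n} (hx : ‖x‖ = 1) (hz : ‖z‖ < 1) : 0 < kernB x z := by
  have h : x - z ≠ 0 := sub_ne_zero.2 (by rintro rfl; linarith)
  have := norm_pos_iff.2 h
  have : 0 < 1 - ‖z‖ ^ 2 := by nlinarith [norm_nonneg z]
  unfold kernB
  positivity

lemma kernB_dMap {n : ℕ} {ξ x z : Eu n} (hξ : ‖ξ‖ < 1) (hx : ‖x‖ ≤ 1) (hz : ‖z‖ < 1) :
    kernB (dMap ξ x) (dMap ξ z) = (1 - ‖ξ‖ ^ 2) / dDen ξ x * kernB x z := by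
  have hD := (dDen_pos hξ hx).ne'
  have hD' := (dDen_pos hξ hz.le).ne'
  have h1 : 1 - ‖ξ‖ ^ 2 ≠ 0 := by nlinarith [norm_nonneg ξ]
  have h2 : 1 - ‖z‖ ^ 2 ≠ 0 := by nlinarith [norm_nonneg z]
  rw [kernB, kernB, norm_dMap_sub_dMap_sq hD hD', norm_dMap_sq hD']
  field_simp
  ring

lemma kernB_dMap_eq_div {n : ℕ} {ξ x z : Eu n} (hξ : ‖ξ‖ < 1) (hx : ‖x‖ = 1) (hz : ‖z‖ < 1) :
    kernB (dMap ξ x) (dMap ξ z) = kernB x z / kernB x (-ξ) := by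
  have h : kernB x (-ξ) = dDen ξ x / (1 - ‖ξ‖ ^ 2) := by
    rw [kernB, dDen, sub_neg_eq_add, norm_add_sq_real, norm_neg, hx, real_inner_comm]
    ring
  rw [kernB_dMap hξ hx.le hz, h, div_div_eq_mul_div]
  ring

lemma kernB_Refl {n : ℕ} {p : Eu n} (hp : ‖p‖ = 1) (x z : Eu n) :
    kernB (Refl p x) (Refl p z) = kernB x z := by
  rw [kernB, kernB, Refl_sub, norm_Refl hp, norm_Refl hp]

lemma kernB_sphere {n : ℕ} {x z : Eu n} (hx : ‖x‖ = 1) :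
    kernB x z = (1 + ‖z‖ ^ 2) / (1 - ‖z‖ ^ 2) - ⟪(2 / (1 - ‖z‖ ^ 2)) • z, x⟫ := by
  rw [kernB, norm_sub_sq_real, hx, inner_smul_left, real_inner_comm]
  simp
  ring

section tau

variable {n : ℕ} {r : ℝ} {p : Eu n}

lemma norm_tauMap_eq_one (hr : r ∈ Ioo (-1 : ℝ) 1) (hp : ‖p‖ = 1) {x : Eu n} (hx : ‖x‖ = 1) :
    ‖tauMap r p x‖ = 1 := by
  have hξ := norm_smul_lt_one hr hp
  exact norm_dMap_eq_one hξ
    ((norm_Refl hp _).trans (norm_dMap_eq_one (by rwa [norm_neg]) hx))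

lemma norm_tauMap_lt_one (hr : r ∈ Ioo (-1 : ℝ) 1) (hp : ‖p‖ = 1) {x : Eu n} (hx : ‖x‖ < 1) :
    ‖tauMap r p x‖ < 1 := by
  have hξ := norm_smul_lt_one hr hp
  exact norm_dMap_lt_one hξ
    ((norm_Refl hp _).trans_lt (norm_dMap_lt_one (by rwa [norm_neg]) hx))

lemma dMap_neg_tauMap (hr : r ∈ Ioo (-1 : ℝ) 1) (hp : ‖p‖ = 1) {x : Eu n} (hx : ‖x‖ ≤ 1) :
    dMap (-(r • p)) (tauMap r p x) = Refl p (dMap (-(r • p)) x) := by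
  have hξ := norm_smul_lt_one hr hp
  exact dMap_neg_dMap hξ
    ((norm_Refl hp _).trans_le (norm_dMap_le_one (by rwa [norm_neg]) hx))

lemma tauMap_tauMap (hr : r ∈ Ioo (-1 : ℝ) 1) (hp : ‖p‖ = 1) {x : Eu n} (hx : ‖x‖ ≤ 1) :
    tauMap r p (tauMap r p x) = x := by
  have hξ := norm_smul_lt_one hr hp
  change dMap (r • p) (Refl p (dMap (-(r • p)) (tauMap r p x))) = x
  rw [dMap_neg_tauMap hr hp hx, Refl_Refl hp]
  simpa using dMap_neg_dMap (ξ := -(r • p)) (by rwa [norm_neg]) hx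

/-- The conformal reflection distorts `kernB` by a factor independent of the interior point. -/
lemma kernB_tauMap (hr : r ∈ Ioo (-1 : ℝ) 1) (hp : ‖p‖ = 1) {x : Eu n} (hx : ‖x‖ = 1) :
    ∃ c : ℝ, c ≠ 0 ∧ ∀ z : Eu n, ‖z‖ < 1 →
      kernB (tauMap r p x) (tauMap r p z) = c * kernB x z := by
  have hξ := norm_smul_lt_one hr hp
  have hξ' : ‖-(r • p)‖ < 1 := by rwa [norm_neg]
  have hy : ‖Refl p (dMap (-(r • p)) x)‖ = 1 :=
    (norm_Refl hp _).trans (norm_dMap_eq_one hξ' hx)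
  refine ⟨(1 - ‖r • p‖ ^ 2) / dDen (r • p) (Refl p (dMap (-(r • p)) x)) *
    ((1 - ‖-(r • p)‖ ^ 2) / dDen (-(r • p)) x), ?_, fun z hz => ?_⟩
  · have h1 : 0 < 1 - ‖r • p‖ ^ 2 := by nlinarith [norm_nonneg (r • p)]
    have h2 : 0 < 1 - ‖-(r • p)‖ ^ 2 := by rwa [norm_neg]
    have h3 := dDen_pos hξ hy.le
    have h4 := dDen_pos hξ' hx.le
    positivity
  · simp only [tauMap, Function.comp_apply]
    rw [kernB_dMap hξ hy.le ((norm_Refl hp _).trans_lt (norm_dMap_lt_one hξ' hz)),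
      kernB_Refl hp, kernB_dMap hξ' hx.le hz, mul_assoc]

end tau

lemma measurable_dMap {n : ℕ} (ξ : Eu n) : Measurable (dMap ξ) := by
  unfold dMap
  fun_prop

lemma measurable_Refl {n : ℕ} (p : Eu n) : Measurable (Refl p) := by
  unfold Refl
  fun_prop

lemma measurable_tauMap {n : ℕ} (r : ℝ) (p : Eu n) : Measurable (tauMap r p) :=
  (measurable_dMap _).comp ((measurable_Refl p).comp (measurable_dMap _))

lemma continuous_dMap_sphere {n : ℕ} {ξ : Eu n} (hξ : ‖ξ‖ < 1) :
    Continuous fun x : sphere (0 : Eu n) 1 => dMap ξ x := by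
  have h : Continuous fun x : sphere (0 : Eu n) 1 =>
      1 + 2 * ⟪ξ, (x : Eu n)⟫ + ‖(x : Eu n)‖ ^ 2 * ‖ξ‖ ^ 2 := by fun_prop
  have h0 (x : sphere (0 : Eu n) 1) :
      1 + 2 * ⟪ξ, (x : Eu n)⟫ + ‖(x : Eu n)‖ ^ 2 * ‖ξ‖ ^ 2 ≠ 0 :=
    (dDen_pos hξ (norm_eq_of_mem_sphere x).le).ne'
  unfold dMap
  exact (h.inv₀ h0).smul (by fun_prop)

lemma mem_cap_iff {n : ℕ} {r : ℝ} (hr : r ∈ Ioo (-1 : ℝ) 1) {p : Eu n} (hp : ‖p‖ = 1)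
    (x : Eu n) : x ∈ cap n r p ↔ ‖x‖ = 1 ∧ 0 < ⟪p, dMap (-(r • p)) x⟫ := by
  have hξ := norm_smul_lt_one hr hp
  have hξ' : ‖-(r • p)‖ < 1 := by rwa [norm_neg]
  simp only [cap, mem_image, mem_ofPred_eq, sphSet, mem_sphere_zero_iff_norm]
  constructor
  · rintro ⟨y, ⟨hy, hpy⟩, rfl⟩
    rw [dMap_neg_dMap hξ hy.le]
    exact ⟨norm_dMap_eq_one hξ hy, hpy⟩
  · rintro ⟨hx, hpx⟩
    refine ⟨_, ⟨norm_dMap_eq_one hξ' hx, hpx⟩, ?_⟩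
    simpa using dMap_neg_dMap (ξ := -(r • p)) hξ' hx.le

lemma measurableSet_cap {n : ℕ} {r : ℝ} (hr : r ∈ Ioo (-1 : ℝ) 1) {p : Eu n} (hp : ‖p‖ = 1) :
    MeasurableSet (cap n r p) := by
  have h : cap n r p = {x | ‖x‖ = 1} ∩ {x | 0 < ⟪p, dMap (-(r • p)) x⟫} := by
    ext x
    exact mem_cap_iff hr hp x
  rw [h]
  have := measurable_dMap (-(r • p))
  exact (measurableSet_eq_fun measurable_norm measurable_const).inter
    (measurableSet_lt measurable_const (by fun_prop))

lemma tauMap_neg_neg {n : ℕ} (r : ℝ) (p : Eu n) : tauMap (-r) (-p) = tauMap r p := by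
  have h : Refl (-p) = Refl p := by
    ext1 x
    simp [Refl]
  rw [tauMap, tauMap, h, neg_smul_neg]

lemma tauMap_mem_cap_neg_iff {n : ℕ} {r : ℝ} (hr : r ∈ Ioo (-1 : ℝ) 1) {p : Eu n}
    (hp : ‖p‖ = 1) {x : Eu n} (hx : ‖x‖ = 1) :
    tauMap r p x ∈ cap n (-r) (-p) ↔ x ∈ cap n r p := by
  rw [mem_cap_iff (by constructor <;> linarith [hr.1, hr.2]) (by rwa [norm_neg]),
    mem_cap_iff hr hp, neg_smul_neg, dMap_neg_tauMap hr hp hx.le, inner_neg_left,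
    inner_self_Refl hp, neg_neg]
  simp [norm_tauMap_eq_one hr hp hx, hx]

lemma ae_norm_eq_one_confMeasure (n : ℕ) (w : Eu n → ℝ) :
    ∀ᵐ x ∂confMeasure n w, ‖x‖ = 1 := by
  refine (withDensity_absolutelyContinuous _ _).ae_le ?_
  refine (ae_map_iff measurable_subtype_coe.aemeasurable
    (measurableSet_eq_fun measurable_norm measurable_const)).2 ?_
  exact Eventually.of_forall fun x => norm_eq_of_mem_sphere x

lemma ae_norm_eq_one_capMeasure {n : ℕ} {w : Eu n → ℝ} {r : ℝ} (hr : r ∈ Ioo (-1 : ℝ) 1)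
    {p : Eu n} (hp : ‖p‖ = 1) : ∀ᵐ x ∂capMeasure n w r p, ‖x‖ = 1 := by
  filter_upwards [ae_restrict_mem (measurableSet_cap hr hp)] with x hx
  exact ((mem_cap_iff hr hp x).1 hx).1

lemma map_tauMap_map_tauMap {n : ℕ} (w : Eu n → ℝ) {r : ℝ} (hr : r ∈ Ioo (-1 : ℝ) 1)
    {p : Eu n} (hp : ‖p‖ = 1) :
    Measure.map (tauMap r p) (Measure.map (tauMap r p) (confMeasure n w)) =
      confMeasure n w := by
  rw [Measure.map_map (measurable_tauMap r p) (measurable_tauMap r p)]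
  conv_rhs => rw [← Measure.map_id (μ := confMeasure n w)]
  refine Measure.map_congr ?_
  filter_upwards [ae_norm_eq_one_confMeasure n w] with x hx
  exact tauMap_tauMap hr hp hx.le

lemma map_tauMap_capMeasure {n : ℕ} (w : Eu n → ℝ) {r : ℝ} (hr : r ∈ Ioo (-1 : ℝ) 1)
    {p : Eu n} (hp : ‖p‖ = 1) :
    Measure.map (tauMap r p) (capMeasure n w r p) = capMeasure n w (-r) (-p) := by
  have hm := measurable_tauMap r p
  have hν : Measure.map (tauMap r p)
      (confMeasure n w + Measure.map (tauMap r p) (confMeasure n w)) =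
      confMeasure n w + Measure.map (tauMap r p) (confMeasure n w) := by
    rw [Measure.map_add _ _ hm, map_tauMap_map_tauMap w hr hp]
    exact add_comm _ _
  have hs : MeasurableSet (cap n (-r) (-p)) :=
    measurableSet_cap (by constructor <;> linarith [hr.1, hr.2]) (by rwa [norm_neg])
  rw [capMeasure, capMeasure, tauMap_neg_neg]
  conv_rhs => rw [← hν]
  rw [Measure.restrict_map hm hs]
  congr 1
  refine Measure.restrict_congr_set ?_
  have hnorm : ∀ᵐ x ∂(confMeasure n w + Measure.map (tauMap r p) (confMeasure n w)),
      ‖x‖ = 1 := by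
    refine ae_add_measure_iff.2 ⟨ae_norm_eq_one_confMeasure n w, ?_⟩
    refine (ae_map_iff hm.aemeasurable
      (measurableSet_eq_fun measurable_norm measurable_const)).2 ?_
    filter_upwards [ae_norm_eq_one_confMeasure n w] with x hx
    exact norm_tauMap_eq_one hr hp hx
  filter_upwards [hnorm] with x hx
  exact propext (tauMap_mem_cap_neg_iff hr hp hx).symm

lemma Renormalizes.integral_inner_eq_zero {n : ℕ} {ξ : Eu n} {μ : Measure (Eu n)}
    (h : Renormalizes ξ μ) (v : Eu n) : ∫ x, ⟪v, dMap ξ x⟫ ∂μ = 0 := by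
  rcases eq_or_ne v 0 with rfl | hv
  · simp
  · have h1 := h (‖v‖⁻¹ • v) (by simp [sphSet, norm_smul, hv])
    simp only [Xfun, inner_smul_left, integral_const_mul] at h1
    simpa [hv] using h1

lemma sphMeasure_ne_zero {n : ℕ} {s : Set (Eu n)} (hs : MeasurableSet s)
    (ho : IsOpen ((↑) ⁻¹' s : Set (sphere (0 : Eu n) 1))) {x : Eu n} (hx : ‖x‖ = 1)
    (hxs : x ∈ s) : sphMeasure n s ≠ 0 := by
  rw [sphMeasure, Measure.map_apply measurable_subtype_coe hs]
  exact ho.measure_ne_zero _ ⟨⟨x, mem_sphere_zero_iff_norm.2 hx⟩, hxs⟩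

/-- An open nonempty condition on the cap is not null for `capMeasure`. -/
lemma capMeasure_ne_zero {n : ℕ} {w : Eu n → ℝ} (hw : IsConformalFactor n w) {r : ℝ}
    (hr : r ∈ Ioo (-1 : ℝ) 1) {p : Eu n} (hp : ‖p‖ = 1) {s : Set (Eu n)} (hs : MeasurableSet s)
    (ho : IsOpen ((↑) ⁻¹' s : Set (sphere (0 : Eu n) 1))) {x : Eu n} (hx : x ∈ cap n r p)
    (hxs : x ∈ s) : capMeasure n w r p s ≠ 0 := by
  have hξ' : ‖-(r • p)‖ < 1 := by rw [norm_neg]; exact norm_smul_lt_one hr hp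
  have hc := measurableSet_cap hr hp
  intro h0
  rw [capMeasure, Measure.restrict_apply hs, Measure.add_apply, add_eq_zero] at h0
  have hmeas : Measurable fun x => ENNReal.ofReal (w x ^ n) :=
    ENNReal.measurable_ofReal.comp (hw.1.continuous.measurable.pow_const n)
  have h1 := (withDensity_apply_eq_zero hmeas).1 h0.1
  refine sphMeasure_ne_zero (s := {x | ENNReal.ofReal (w x ^ n) ≠ 0} ∩ (s ∩ cap n r p))
    ((hmeas (measurableSet_singleton 0).compl).inter (hs.inter hc)) ?_
    ((mem_cap_iff hr hp x).1 hx).1 ⟨?_, hxs, hx⟩ h1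
  · have : ((↑) ⁻¹' ({x | ENNReal.ofReal (w x ^ n) ≠ 0} ∩ (s ∩ cap n r p)) :
        Set (sphere (0 : Eu n) 1)) =
        (↑) ⁻¹' s ∩ {x : sphere (0 : Eu n) 1 | 0 < ⟪p, dMap (-(r • p)) x⟫} := by
      ext x
      have := hw.2 x x.2
      have h2 : 0 < w x ^ n := pow_pos this n
      simp [mem_cap_iff hr hp, h2]
    rw [this]
    refine ho.inter (isOpen_lt continuous_const ?_)
    exact continuous_const.inner (continuous_dMap_sphere hξ')
  · exact (ENNReal.ofReal_pos.2
      (pow_pos (hw.2 x (mem_sphere_zero_iff_norm.2 ((mem_cap_iff hr hp x).1 hx).1)) n)).ne'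

lemma exists_norm_eq_one_inner_eq_zero {n : ℕ} (hn : 1 ≤ n) (p : Eu n) :
    ∃ q : Eu n, ‖q‖ = 1 ∧ ⟪p, q⟫ = 0 := by
  have h : (ℝ ∙ p)ᗮ ≠ ⊥ := by
    intro h
    have h1 := Submodule.finrank_add_finrank_orthogonal (ℝ ∙ p)
    have h2 := finrank_span_le_card (R := ℝ) {p}
    rw [h, finrank_bot, finrank_euclideanSpace_fin] at h1
    rw [toFinset_singleton, Finset.card_singleton] at h2
    omega
  obtain ⟨q, hq, hq0⟩ := Submodule.exists_mem_ne_zero_of_ne_bot h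
  refine ⟨‖q‖⁻¹ • q, by simp [norm_smul, hq0], ?_⟩
  rw [inner_smul_right, Submodule.mem_orthogonal_singleton_iff_inner_right.1 hq, mul_zero]

/-- Equality case of the Cauchy-Schwarz inequality for a unit vector `y`. -/
lemma smul_eq_of_inner_sq_eq {n : ℕ} {v y : Eu n} (hy : ‖y‖ = 1)
    (h : ⟪v, y⟫ ^ 2 = ‖v‖ ^ 2) : v = ⟪v, y⟫ • y := by
  rw [← sub_eq_zero, ← norm_eq_zero, ← sq_eq_zero_iff, norm_sub_sq_real, inner_smul_right,
    norm_smul, hy, mul_one, Real.norm_eq_abs, sq_abs]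
  linarith

/-- Every cap contains a point whose image under `dMap ξ` is not on the axis of `v ≠ 0`. -/
lemma exists_mem_cap_inner_sq_ne {n : ℕ} (hn : 1 ≤ n) {r : ℝ} (hr : r ∈ Ioo (-1 : ℝ) 1)
    {p : Eu n} (hp : ‖p‖ = 1) {ξ v : Eu n} (hξ : ‖ξ‖ < 1) (hv : v ≠ 0) :
    ∃ x ∈ cap n r p, ⟪v, dMap ξ x⟫ ^ 2 ≠ ‖v‖ ^ 2 := by
  by_contra! hall
  have hrp := norm_smul_lt_one hr hp
  obtain ⟨q, hq, hpq⟩ := exists_norm_eq_one_inner_eq_zero hn p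
  let y : ℝ → Eu n := fun t => (3 / 5 : ℝ) • p + t • q
  have hy (t : ℝ) (ht : t ^ 2 = 16 / 25) : ‖y t‖ = 1 := by
    rw [← pow_eq_one_iff_of_nonneg (norm_nonneg _) two_ne_zero, norm_add_sq_real,
      inner_smul_left, inner_smul_right, hpq, norm_smul, norm_smul, hp, hq]
    simp [ht]
    norm_num
  have hyp (t : ℝ) : 0 < ⟪p, y t⟫ := by
    simp only [y, inner_add_right, inner_smul_right, hpq, real_inner_self_eq_norm_sq, hp]
    norm_num
  have hinj {a b : Eu n} (ha : ‖a‖ = 1) (hb : ‖b‖ = 1)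
      (hab : dMap ξ (dMap (r • p) a) = dMap ξ (dMap (r • p) b)) : a = b := by
    have h1 := congrArg (dMap (-ξ)) hab
    rw [dMap_neg_dMap hξ (norm_dMap_le_one hrp ha.le),
      dMap_neg_dMap hξ (norm_dMap_le_one hrp hb.le)] at h1
    have h2 := congrArg (dMap (-(r • p))) h1
    rwa [dMap_neg_dMap hrp ha.le, dMap_neg_dMap hrp hb.le] at h2
  have key {a : Eu n} (ha : ‖a‖ = 1) (hpa : 0 < ⟪p, a⟫) :
      dMap ξ (dMap (r • p) a) = ‖v‖⁻¹ • v ∨ dMap ξ (dMap (r • p) a) = -(‖v‖⁻¹ • v) := by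
    have h1 := hall _ ⟨a, ⟨mem_sphere_zero_iff_norm.2 ha, hpa⟩, rfl⟩
    have h2 := smul_eq_of_inner_sq_eq (norm_dMap_eq_one hξ (norm_dMap_eq_one hrp ha)) h1
    have hv' : ‖v‖ ≠ 0 := norm_ne_zero_iff.2 hv
    rcases sq_eq_sq_iff_eq_or_eq_neg.1 h1 with h3 | h3
    · left
      rw [h3] at h2
      rw [eq_inv_smul_iff₀ hv', ← h2]
    · right
      rw [h3, neg_smul] at h2
      rw [← smul_neg, eq_inv_smul_iff₀ hv', eq_neg_iff_add_eq_zero, add_comm]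
      nth_rw 1 [h2]
      simp
  have hp1 : 0 < ⟪p, p⟫ := by rw [real_inner_self_eq_norm_sq, hp]; norm_num
  have n1 := hy (4 / 5) (by norm_num)
  have n2 := hy (-(4 / 5)) (by norm_num)
  have hqp : ⟪q, p⟫ = 0 := by rw [real_inner_comm, hpq]
  have hqy (t : ℝ) : ⟪q, y t⟫ = t := by simp [y, inner_add_right, inner_smul_right, hqp, hq]
  have d1 : p ≠ y (4 / 5) := fun h => by
    have := hqy (4 / 5); rw [← h, hqp] at this; norm_num at this
  have d2 : p ≠ y (-(4 / 5)) := fun h => by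
    have := hqy (-(4 / 5)); rw [← h, hqp] at this; norm_num at this
  have d3 : y (4 / 5) ≠ y (-(4 / 5)) := fun h => by
    have := hqy (4 / 5); rw [h, hqy] at this; norm_num at this
  rcases key hp hp1 with h1 | h1 <;> rcases key n1 (hyp _) with h2 | h2 <;>
    rcases key n2 (hyp _) with h3 | h3
  all_goals first
    | exact d1 (hinj hp n1 (h1.trans h2.symm))
    | exact d2 (hinj hp n2 (h1.trans h3.symm))
    | exact d3 (hinj n1 n2 (h2.trans h3.symm))

lemma integrable_inner_dMap {n : ℕ} {μ : Measure (Eu n)} [IsFiniteMeasure μ]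
    (hμ : ∀ᵐ x ∂μ, ‖x‖ = 1) {ξ : Eu n} (hξ : ‖ξ‖ < 1) (v : Eu n) :
    Integrable (fun x => ⟪v, dMap ξ x⟫) μ := by
  have := measurable_dMap ξ
  refine Integrable.of_bound (C := ‖v‖) (by fun_prop) ?_
  filter_upwards [hμ] with x hx
  simpa [norm_dMap_eq_one hξ hx] using norm_inner_le_norm (𝕜 := ℝ) v (dMap ξ x)

lemma Renormalizes.integral_const_sub_inner {n : ℕ} {μ : Measure (Eu n)} [IsFiniteMeasure μ]
    (hμ : ∀ᵐ x ∂μ, ‖x‖ = 1) {ξ : Eu n} (hξ : ‖ξ‖ < 1) (h : Renormalizes ξ μ)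
    (C : ℝ) (v : Eu n) : ∫ x, (C - ⟪v, dMap ξ x⟫) ∂μ = C * μ.real univ := by
  rw [integral_sub (integrable_const C) (integrable_inner_dMap hμ hξ v),
    h.integral_inner_eq_zero, integral_const, smul_eq_mul]
  ring

lemma isFiniteMeasure_capMeasure {n : ℕ} {w : Eu n → ℝ} (hvol : confMeasure n w univ = 1)
    (r : ℝ) (p : Eu n) : IsFiniteMeasure (capMeasure n w r p) := by
  have : IsFiniteMeasure (confMeasure n w) := ⟨by simp [hvol]⟩
  unfold capMeasure
  infer_instance

lemma exists_kernB_eq_sub_inner {n : ℕ} {z : Eu n} (hz : ‖z‖ < 1) :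
    ∃ (C : ℝ) (v : Eu n), ‖v‖ ^ 2 = C ^ 2 - 1 ∧ (v = 0 → z = 0) ∧
      ∀ x : Eu n, ‖x‖ = 1 → kernB x z = C - ⟪v, x⟫ := by
  have h : 0 < 1 - ‖z‖ ^ 2 := by nlinarith [norm_nonneg z]
  refine ⟨(1 + ‖z‖ ^ 2) / (1 - ‖z‖ ^ 2), (2 / (1 - ‖z‖ ^ 2)) • z, ?_, fun hv => ?_,
    fun x hx => kernB_sphere hx⟩
  · rw [norm_smul, mul_pow, Real.norm_eq_abs, sq_abs]
    field_simp
    ring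
  · exact (smul_eq_zero.1 hv).resolve_left (by positivity)

lemma mul_two_mul_sub_add {F G C s : ℝ} (hFG : F * G = 1) (hFs : F = C - s) :
    F * (2 * C - (F + G)) = C ^ 2 - 1 - s ^ 2 := by
  obtain rfl : s = C - F := by linarith
  linear_combination -hFG

lemma add_le_two_mul {n : ℕ} {F G C : ℝ} {v y : Eu n} (hF : 0 < F) (hFG : F * G = 1)
    (hy : ‖y‖ = 1) (hv : ‖v‖ ^ 2 = C ^ 2 - 1) (hFs : F = C - ⟪v, y⟫) : F + G ≤ 2 * C := by
  have h := mul_two_mul_sub_add hFG hFs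
  have h1 : ⟪v, y⟫ ^ 2 ≤ ‖v‖ ^ 2 := by
    have := abs_real_inner_le_norm v y
    rw [hy, mul_one] at this
    exact sq_le_sq.2 (by rwa [abs_norm])
  have h2 : 0 ≤ F * (2 * C - (F + G)) := by linarith
  linarith [nonneg_of_mul_nonneg_right h2 hF]

/-- If `ξ` and `ξ*` are the renormalization points of `μ_a` and `μ_{a*}`
(for the cap `a = a_{r,p}`, with `a* = a_{-r,-p}`), then `-ξ* = τ_a(-ξ)`. -/
theorem renormalization_point_of_symmetric_cap (n : ℕ) (hn : 2 ≤ n)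
    (w : Eu n → ℝ) (hw : IsConformalFactor n w) (hvol : confMeasure n w Set.univ = 1)
    (r : ℝ) (hr : r ∈ Set.Ioo (-1 : ℝ) 1) (p : Eu n) (hp : p ∈ sphSet n)
    (ξ ξs : Eu n) (hξ : ‖ξ‖ < 1) (hξs : ‖ξs‖ < 1)
    (hren : Renormalizes ξ (capMeasure n w r p))
    (hrens : Renormalizes ξs (capMeasure n w (-r) (-p))) :
    -ξs = tauMap r p (-ξ) := by
  have hp1 : ‖p‖ = 1 := mem_sphere_zero_iff_norm.1 hp
  have hmξ : ‖-ξ‖ < 1 := by rwa [norm_neg]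
  have hmξs : ‖-ξs‖ < 1 := by rwa [norm_neg]
  have hz := norm_tauMap_lt_one hr hp1 hmξs
  have hτξ := norm_tauMap_lt_one hr hp1 hmξ
  by_cases heq : dMap ξ (tauMap r p (-ξs)) = 0
  · have h := dMap_neg_dMap hξ hz.le
    rw [heq, dMap_zero_right] at h
    rw [h, tauMap_tauMap hr hp1 hmξs.le]
  exfalso
  obtain ⟨C, v, hvC, hv0, hker⟩ := exists_kernB_eq_sub_inner (norm_dMap_lt_one hξ hz)
  obtain ⟨C', v', hvC', -, hker'⟩ := exists_kernB_eq_sub_inner (norm_dMap_lt_one hξs hτξ)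
  have hv : v ≠ 0 := fun h => heq (hv0 h)
  have hr' : -r ∈ Ioo (-1 : ℝ) 1 := by constructor <;> linarith [hr.1, hr.2]
  have hp1' : ‖-p‖ = 1 := by rwa [norm_neg]
  have := isFiniteMeasure_capMeasure hvol r p
  have := isFiniteMeasure_capMeasure hvol (-r) (-p)
  have hae := ae_norm_eq_one_capMeasure (w := w) hr hp1
  have hae' := ae_norm_eq_one_capMeasure (w := w) hr' hp1'
  have hτm := measurable_tauMap r p
  have hmap := map_tauMap_capMeasure w hr hp1
  let F : Eu n → ℝ := fun x => C - ⟪v, dMap ξ x⟫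
  let H : Eu n → ℝ := fun y => C' - ⟪v', dMap ξs y⟫
  have hFpos (x : Eu n) (hx : ‖x‖ = 1) : 0 < F x := by
    simp only [F, ← hker _ (norm_dMap_eq_one hξ hx)]
    exact kernB_pos (norm_dMap_eq_one hξ hx) (norm_dMap_lt_one hξ hz)
  have hFH (x : Eu n) (hx : ‖x‖ = 1) : F x * H (tauMap r p x) = 1 := by
    have hτx := norm_tauMap_eq_one hr hp1 hx
    obtain ⟨c, hc, hcz⟩ := kernB_tauMap hr hp1 hx
    have h1 := hcz _ hz
    rw [tauMap_tauMap hr hp1 hmξs.le] at h1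
    simp only [F, H]
    rw [← hker _ (norm_dMap_eq_one hξ hx), ← hker' _ (norm_dMap_eq_one hξs hτx),
      kernB_dMap_eq_div hξ hx hz, kernB_dMap_eq_div hξs hτx hτξ, h1, hcz _ hmξ]
    have h2 := (kernB_pos hx hz).ne'
    have h3 := (kernB_pos hx hmξ).ne'
    field_simp
  have hle (x : Eu n) (hx : ‖x‖ = 1) : F x + H (tauMap r p x) ≤ 2 * C :=
    add_le_two_mul (hFpos x hx) (hFH x hx) (norm_dMap_eq_one hξ hx) hvC rfl
  have hle' (x : Eu n) (hx : ‖x‖ = 1) : F x + H (tauMap r p x) ≤ 2 * C' := by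
    have hτx := norm_tauMap_eq_one hr hp1 hx
    rw [add_comm]
    refine add_le_two_mul (pos_of_mul_pos_right ?_ (hFpos x hx).le) ?_
      (norm_dMap_eq_one hξs hτx) hvC' rfl
    · rw [hFH x hx]
      exact one_pos
    · rw [mul_comm, hFH x hx]
  have hFint : Integrable F (capMeasure n w r p) :=
    (integrable_const C).sub (integrable_inner_dMap hae hξ v)
  have hHint : Integrable H (capMeasure n w (-r) (-p)) :=
    (integrable_const C').sub (integrable_inner_dMap hae' hξs v')
  have hHτint : Integrable (fun x => H (tauMap r p x)) (capMeasure n w r p) := by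
    rw [← hmap] at hHint
    exact hHint.comp_measurable hτm
  have hFI : ∫ x, F x ∂capMeasure n w r p = C * (capMeasure n w r p).real univ :=
    hren.integral_const_sub_inner hae hξ C v
  have hHI : ∫ x, H (tauMap r p x) ∂capMeasure n w r p =
      C' * (capMeasure n w r p).real univ := by
    have h1 : ∫ y, H y ∂capMeasure n w (-r) (-p) =
        C' * (capMeasure n w (-r) (-p)).real univ :=
      hrens.integral_const_sub_inner hae' hξs C' v'
    have h2 : (capMeasure n w (-r) (-p)).real univ = (capMeasure n w r p).real univ := by
      rw [← hmap, map_measureReal_apply hτm MeasurableSet.univ, preimage_univ]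
    rw [h2, ← hmap, integral_map hτm.aemeasurable] at h1
    · exact h1
    · rw [hmap]
      exact hHint.aestronglyMeasurable
  have hsum : Integrable (fun x => F x + H (tauMap r p x)) (capMeasure n w r p) :=
    hFint.add hHτint
  have hdiff : Integrable (fun x => C + C' - (F x + H (tauMap r p x)))
      (capMeasure n w r p) := (integrable_const _).sub hsum
  have hzero : ∫ x, (C + C' - (F x + H (tauMap r p x))) ∂capMeasure n w r p = 0 := by
    rw [integral_sub (integrable_const _) hsum, integral_add hFint hHτint,
      hFI, hHI, integral_const, smul_eq_mul]
    ring
  have hae0 := (integral_eq_zero_iff_of_nonneg_ae (by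
    filter_upwards [hae] with x hx
    have := hle x hx
    have := hle' x hx
    simp only [Pi.zero_apply]
    linarith) hdiff).1 hzero
  obtain ⟨x, hx, hxv⟩ := exists_mem_cap_inner_sq_ne (by omega) hr hp1 hξ hv
  have hdm := measurable_dMap ξ
  refine capMeasure_ne_zero (s := {x | ⟪v, dMap ξ x⟫ ^ 2 ≠ ‖v‖ ^ 2}) hw hr hp1 ?_ ?_ hx hxv ?_
  · exact (measurableSet_eq_fun (by fun_prop) measurable_const).compl
  · exact isOpen_ne_fun ((continuous_const.inner (continuous_dMap_sphere hξ)).pow 2)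
      continuous_const
  · refine measure_mono_null (fun x hx => ?_) (ae_iff.1 (hae0.and hae))
    rintro ⟨h0, hx1⟩
    simp only [Pi.zero_apply] at h0
    have h1 : 2 * C - (F x + H (tauMap r p x)) = 0 := by linarith [hle x hx1, hle' x hx1]
    have h2 := mul_two_mul_sub_add (hFH x hx1) rfl
    rw [h1, mul_zero, ← hvC] at h2
    exact hx (by linarith)

end
end
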